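/- Let f : (X,r) → (U,s) be an i-homomorphism of non-degenerate solutions with i-kernel X₀ ⊆ X, and let (G_X, ι) be the structure skew brace of (X,r). Then the subgroup of (G_X,·) generated by ι(X₀) coincides with the subgroup of (G_X,+) generated by ι(X₀), and this subgroup is a strong left ideal of G_X. -/

import Mathlib

/-!
Common definitions: skew braces, set-theoretic solutions of the Yang–Baxter
equation, structure skew braces, ideals, i-homomorphisms, solubility.
-/

universe u v

/-- A skew (left) brace: two group structures `(B,+)` and `(B,·)` sharing the
same identity `0`, with `a·(b+c) = a·b − a + a·c`. -/
structure SkewBrace (B : Type u) where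
  add : B → B → B
  zero : B
  neg : B → B
  mul : B → B → B
  inv : B → B
  add_assoc : ∀ a b c, add (add a b) c = add a (add b c)
  zero_add : ∀ a, add zero a = a
  add_zero : ∀ a, add a zero = a
  neg_add : ∀ a, add (neg a) a = zero
  add_neg : ∀ a, add a (neg a) = zero
  mul_assoc : ∀ a b c, mul (mul a b) c = mul a (mul b c)
  zero_mul : ∀ a, mul zero a = a
  mul_zero : ∀ a, mul a zero = a
  inv_mul : ∀ a, mul (inv a) a = zero
  mul_inv : ∀ a, mul a (inv a) = zero
  compat : ∀ a b c, mul a (add b c) = add (add (mul a b) (neg a)) (mul a c)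

namespace SkewBrace

variable {B : Type u} (S : SkewBrace B)

/-- `λ_a(b) = −a + a·b`. -/
def lam (a b : B) : B := S.add (S.neg a) (S.mul a b)

/-- `ρ_b(a) = λ_a(b)⁻¹ · a · b`. -/
def rho (b a : B) : B := S.mul (S.mul (S.inv (S.lam a b)) a) b

/-- The solution of the YBE associated with a skew brace:
`r_B(a,b) = (λ_a(b), ρ_b(a))`. -/
def rB : B × B → B × B := fun p => (S.lam p.1 p.2, S.rho p.2 p.1)

end SkewBrace

/-- Homomorphism of skew braces: preserves both operations. -/
def IsHom {B : Type u} {C : Type v} (S : SkewBrace B) (T : SkewBrace C) (f : B → C) : Prop :=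
  (∀ a b, f (S.add a b) = T.add (f a) (f b)) ∧ (∀ a b, f (S.mul a b) = T.mul (f a) (f b))

/-- The kernel of a skew brace homomorphism: preimage of `0`. -/
def brKer {B : Type u} {C : Type v} (T : SkewBrace C) (f : B → C) : Set B :=
  {a | f a = T.zero}

/-- An ideal of a skew brace: a sub-skew brace, normal in both `(B,+)` and `(B,·)`,
and `λ_b`-invariant for all `b`. -/
def IsIdeal {B : Type u} (S : SkewBrace B) (I : Set B) : Prop :=
  S.zero ∈ I ∧
  (∀ a ∈ I, ∀ b ∈ I, S.add a b ∈ I) ∧ (∀ a ∈ I, S.neg a ∈ I) ∧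
  (∀ a ∈ I, ∀ b ∈ I, S.mul a b ∈ I) ∧ (∀ a ∈ I, S.inv a ∈ I) ∧
  (∀ b : B, ∀ a ∈ I, S.add (S.add b a) (S.neg b) ∈ I) ∧
  (∀ b : B, ∀ a ∈ I, S.mul (S.mul b a) (S.inv b) ∈ I) ∧
  (∀ b : B, S.lam b '' I = I)

/-- A skew brace is simple if it is non-trivial and its only ideals are `{0}` and `B`. -/
def IsSimpleBrace {B : Type u} (S : SkewBrace B) : Prop :=
  (∃ a : B, a ≠ S.zero) ∧
  ∀ I : Set B, IsIdeal S I → I = {S.zero} ∨ I = Set.univ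

/-- The socle of a skew brace: elements `a` with `λ_a = id` commuting additively
with everything. -/
def Soc {B : Type u} (S : SkewBrace B) : Set B :=
  {a | (∀ b, S.lam a b = b) ∧ (∀ b, S.add a b = S.add b a)}

/-- `r × id` on triples. -/
def rOne {X : Type u} (r : X × X → X × X) : X × X × X → X × X × X :=
  fun p => ((r (p.1, p.2.1)).1, (r (p.1, p.2.1)).2, p.2.2)

/-- `id × r` on triples. -/
def rTwo {X : Type u} (r : X × X → X × X) : X × X × X → X × X × X :=
  fun p => (p.1, r p.2)

/-- `(X,r)` is a set-theoretic solution of the Yang–Baxter equation. -/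
def IsSolution {X : Type u} (r : X × X → X × X) : Prop :=
  Function.Bijective r ∧
  rOne r ∘ rTwo r ∘ rOne r = rTwo r ∘ rOne r ∘ rTwo r

/-- `λ_x(y)` for a solution, i.e. the first component of `r(x,y)`. -/
def lamMap {X : Type u} (r : X × X → X × X) (x : X) : X → X := fun y => (r (x, y)).1

/-- `ρ_y(x)` for a solution, i.e. the second component of `r(x,y)`. -/
def rhoMap {X : Type u} (r : X × X → X × X) (y : X) : X → X := fun x => (r (x, y)).2

/-- Non-degeneracy: all `λ_x` and `ρ_y` are bijective. -/
def Nondeg {X : Type u} (r : X × X → X × X) : Prop :=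
  (∀ x, Function.Bijective (lamMap r x)) ∧ (∀ y, Function.Bijective (rhoMap r y))

/-- Homomorphism of solutions: `(f×f)∘r = s∘(f×f)`. -/
def IsSolHom {X : Type u} {Y : Type v} (r : X × X → X × X) (s : Y × Y → Y × Y)
    (f : X → Y) : Prop :=
  Prod.map f f ∘ r = s ∘ Prod.map f f

/-- The structure skew brace `(G_X, ι)` of a solution `(X,r)`: the image of `ι`
generates `(G_X,·)`, `ι` intertwines `r` with `r_{G_X}`, and the pair has the
universal property for maps into skew braces. -/
structure StructureBrace {X : Type u} (r : X × X → X × X) where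
  G : Type u
  S : SkewBrace G
  ι : X → G
  gen : ∀ H : Set G, S.zero ∈ H → (∀ a ∈ H, ∀ b ∈ H, S.mul a b ∈ H) →
      (∀ a ∈ H, S.inv a ∈ H) → Set.range ι ⊆ H → H = Set.univ
  compat : Prod.map ι ι ∘ r = S.rB ∘ Prod.map ι ι
  univ : ∀ {C : Type u} (T : SkewBrace C) (g : X → C),
      Prod.map g g ∘ r = T.rB ∘ Prod.map g g →
      ∃! h : G → C, IsHom S T h ∧ h ∘ ι = g

/-- The multiplicative subgroup (as a set) generated by a subset. -/
def mulClosure {B : Type u} (S : SkewBrace B) (A : Set B) : Set B :=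
  ⋂₀ {H : Set B | S.zero ∈ H ∧ (∀ a ∈ H, ∀ b ∈ H, S.mul a b ∈ H) ∧
      (∀ a ∈ H, S.inv a ∈ H) ∧ A ⊆ H}

/-- The additive subgroup (as a set) generated by a subset. -/
def addClosure {B : Type u} (S : SkewBrace B) (A : Set B) : Set B :=
  ⋂₀ {H : Set B | S.zero ∈ H ∧ (∀ a ∈ H, ∀ b ∈ H, S.add a b ∈ H) ∧
      (∀ a ∈ H, S.neg a ∈ H) ∧ A ⊆ H}

/-- The ideal generated by a subset: intersection of all ideals containing it. -/
def idealClosure {B : Type u} (S : SkewBrace B) (A : Set B) : Set B :=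
  ⋂₀ {I : Set B | IsIdeal S I ∧ A ⊆ I}

/-- Product of two subsets in the multiplicative group. -/
def setMul {B : Type u} (S : SkewBrace B) (A₁ A₂ : Set B) : Set B :=
  {c | ∃ a ∈ A₁, ∃ b ∈ A₂, c = S.mul a b}

/-- Sum of two subsets in the additive group. -/
def setAdd {B : Type u} (S : SkewBrace B) (A₁ A₂ : Set B) : Set B :=
  {c | ∃ a ∈ A₁, ∃ b ∈ A₂, c = S.add a b}

/-- The multiplicative left coset `a·I`. -/
def lCoset {B : Type u} (S : SkewBrace B) (a : B) (I : Set B) : Set B :=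
  (fun w => S.mul a w) '' I

/-- Equivalence class of the kernel relation of a map. -/
def kerClass {X : Type u} {Y : Type v} (f : X → Y) (x : X) : Set X := {z | f z = f x}

/-- `X₀` is an i-kernel of the homomorphism of solutions `f : (X,r) → (Y,s)`:
`f` is a homomorphism of solutions, `X₀` is an equivalence class of `ker f`, and
for every class `Z` of `ker f`, `r(X₀ × Z) = Z × X₀` and `r(Z × X₀) = X₀ × Z`.
A homomorphism admitting such a class is an i-homomorphism. -/
def IsIKernel {X : Type u} {Y : Type v} (r : X × X → X × X) (s : Y × Y → Y × Y)
    (f : X → Y) (X₀ : Set X) : Prop :=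
  IsSolHom r s f ∧ (∃ x : X, X₀ = kerClass f x) ∧
  ∀ z : X, r '' (X₀ ×ˢ kerClass f z) = (kerClass f z) ×ˢ X₀ ∧
           r '' ((kerClass f z) ×ˢ X₀) = X₀ ×ˢ (kerClass f z)

/-- A strong left ideal: a `λ`-invariant subgroup of `(B,+)` which is normal
in `(B,+)`. -/
def IsStrongLeftIdeal {B : Type u} (S : SkewBrace B) (I : Set B) : Prop :=
  S.zero ∈ I ∧ (∀ a ∈ I, ∀ b ∈ I, S.add a b ∈ I) ∧ (∀ a ∈ I, S.neg a ∈ I) ∧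
  (∀ b : B, S.lam b '' I = I) ∧
  (∀ b : B, ∀ a ∈ I, S.add (S.add b a) (S.neg b) ∈ I)

/-- An abelian ideal: an ideal on which the two operations coincide and are
commutative (so it is an abelian/trivial skew brace). -/
def IsAbelianIdeal {C : Type u} (T : SkewBrace C) (J : Set C) : Prop :=
  IsIdeal T J ∧ ∀ a ∈ J, ∀ b ∈ J, T.mul a b = T.add a b ∧ T.add a b = T.add b a

/-- Solubility of a skew brace: epimorphisms `f_k : B → B_k`, `0 ≤ k ≤ t`, with
`Ker f_t = 0 ⊆ … ⊆ Ker f_0 = B` and `f_k(Ker f_{k−1})` an abelian ideal of `B_k`. -/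
def IsSoluble {B : Type u} (S : SkewBrace B) : Prop :=
  ∃ (t : ℕ) (C : Fin (t + 1) → Type u) (T : ∀ k, SkewBrace (C k)) (f : ∀ k, B → C k),
    (∀ k, IsHom S (T k) (f k) ∧ Function.Surjective (f k)) ∧
    brKer (T (Fin.last t)) (f (Fin.last t)) = {S.zero} ∧
    brKer (T 0) (f 0) = Set.univ ∧
    (∀ k : Fin t, brKer (T k.succ) (f k.succ) ⊆ brKer (T k.castSucc) (f k.castSucc)) ∧
    (∀ k : Fin t, IsAbelianIdeal (T k.succ) (f k.succ '' brKer (T k.castSucc) (f k.castSucc)))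

/-- Solubility of a solution `(X,r)` (with structure skew brace `(G_X, ι)`):
there are skew braces `B_0,…,B_t`, i-epimorphisms `f_k : (X,r) → (B_k, r_{B_k})`
with i-kernels `X_k` for `0 ≤ k ≤ t−1`, and an epimorphism `f_t`, such that
`ker f_k ⊆ ker f_{k−1}`, `ker f_0` is total, `ker f_t ⊆ ker ι`, and each
`f_k(X_{k−1})` lies in an abelian ideal `J` of `B_k` with `f_k(x)·J = f_k(y)·J`
whenever `x (ker f_{k−1}) y`. -/
def IsSolubleSolution {X : Type u} (r : X × X → X × X) (GX : StructureBrace r) : Prop :=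
  ∃ (t : ℕ) (C : Fin (t + 1) → Type u) (T : ∀ k, SkewBrace (C k))
    (f : ∀ k : Fin (t + 1), X → C k) (Xk : Fin t → Set X),
    (∀ k : Fin (t + 1), IsSolHom r (T k).rB (f k) ∧ Function.Surjective (f k)) ∧
    (∀ k : Fin t, IsIKernel r (T k.castSucc).rB (f k.castSucc) (Xk k)) ∧
    (∀ x y : X, f 0 x = f 0 y) ∧
    (∀ k : Fin t, ∀ x y : X, f k.succ x = f k.succ y → f k.castSucc x = f k.castSucc y) ∧
    (∀ x y : X, f (Fin.last t) x = f (Fin.last t) y → GX.ι x = GX.ι y) ∧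
    (∀ k : Fin t, ∃ J : Set (C k.succ), IsAbelianIdeal (T k.succ) J ∧
      f k.succ '' (Xk k) ⊆ J ∧
      ∀ x y : X, f k.castSucc x = f k.castSucc y →
        lCoset (T k.succ) (f k.succ x) J = lCoset (T k.succ) (f k.succ y) J)

/-- Decomposability of a solution: `X = Y ∪ Z` with `Y, Z` proper and
`r(Y×Y) = Y×Y`, `r(Z×Z) = Z×Z`. -/
def Decomposable {X : Type u} (r : X × X → X × X) : Prop :=
  ∃ Y Z : Set X, Y ≠ Set.univ ∧ Z ≠ Set.univ ∧ Y ∪ Z = Set.univ ∧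
    r '' (Y ×ˢ Y) = Y ×ˢ Y ∧ r '' (Z ×ˢ Z) = Z ×ˢ Z

namespace SkewBrace

variable {B : Type u} (S : SkewBrace B)

theorem neg_add_cancel_left (a b : B) : S.add (S.neg a) (S.add a b) = b := by
  rw [← S.add_assoc, S.neg_add, S.zero_add]

theorem add_neg_cancel_left (a b : B) : S.add a (S.add (S.neg a) b) = b := by
  rw [← S.add_assoc, S.add_neg, S.zero_add]

theorem neg_eq_of_add_eq_zero {a b : B} (h : S.add a b = S.zero) : S.neg a = b := by
  rw [← S.neg_add_cancel_left a b, h, S.add_zero]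

theorem neg_neg (a : B) : S.neg (S.neg a) = a :=
  S.neg_eq_of_add_eq_zero (S.neg_add a)

theorem neg_zero : S.neg S.zero = S.zero :=
  S.neg_eq_of_add_eq_zero (S.zero_add _)

theorem neg_add_rev (a b : B) : S.neg (S.add a b) = S.add (S.neg b) (S.neg a) :=
  S.neg_eq_of_add_eq_zero (by rw [S.add_assoc, S.add_neg_cancel_left, S.add_neg])

theorem mul_eq_add_lam (a b : B) : S.mul a b = S.add a (S.lam a b) :=
  (S.add_neg_cancel_left a _).symm

theorem lam_add (a b c : B) : S.lam a (S.add b c) = S.add (S.lam a b) (S.lam a c) := by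
  simp only [lam, S.compat, S.add_assoc]

theorem lam_mul (a b c : B) : S.lam (S.mul a b) c = S.lam a (S.lam b c) := by
  have h : S.add (S.mul a b) (S.lam (S.mul a b) c)
      = S.add (S.mul a b) (S.lam a (S.lam b c)) := by
    rw [← S.mul_eq_add_lam, S.mul_assoc, S.mul_eq_add_lam b c, S.mul_eq_add_lam a (S.add _ _),
      S.lam_add, ← S.add_assoc, ← S.mul_eq_add_lam]
  rw [← S.neg_add_cancel_left (S.mul a b) (S.lam _ c), h, S.neg_add_cancel_left]

theorem lam_zero_left (a : B) : S.lam S.zero a = a := by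
  rw [lam, S.neg_zero, S.zero_add, S.zero_mul]

theorem lam_zero_right (a : B) : S.lam a S.zero = S.zero := by
  rw [lam, S.mul_zero, S.neg_add]

theorem lam_neg (a b : B) : S.lam a (S.neg b) = S.neg (S.lam a b) :=
  (S.neg_eq_of_add_eq_zero (by rw [← S.lam_add, S.add_neg, S.lam_zero_right])).symm

theorem lam_inv_lam (a b : B) : S.lam (S.inv a) (S.lam a b) = b := by
  rw [← S.lam_mul, S.inv_mul, S.lam_zero_left]

theorem lam_lam_inv (a b : B) : S.lam a (S.lam (S.inv a) b) = b := by
  rw [← S.lam_mul, S.mul_inv, S.lam_zero_left]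

theorem inv_inv (a : B) : S.inv (S.inv a) = a := by
  rw [← S.mul_zero (S.inv (S.inv a)), ← S.inv_mul a, ← S.mul_assoc, S.inv_mul, S.zero_mul]

theorem inv_eq_neg_lam (a : B) : S.inv a = S.neg (S.lam (S.inv a) a) := by
  rw [← S.neg_neg (S.inv a)]
  congr 1
  rw [S.neg_neg]
  exact S.neg_eq_of_add_eq_zero (by rw [← S.mul_eq_add_lam, S.inv_mul])

theorem mul_rho (a b : B) : S.mul (S.lam a b) (S.rho b a) = S.mul a b := by
  rw [rho, ← S.mul_assoc, ← S.mul_assoc, S.mul_inv, S.zero_mul]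

/-- The defining relation of the additive group of the structure skew brace. -/
theorem lam_add_lam_rho (a b : B) :
    S.add (S.lam a b) (S.lam (S.lam a b) (S.rho b a)) = S.add a (S.lam a b) := by
  rw [← S.mul_eq_add_lam, ← S.mul_eq_add_lam, S.mul_rho]

end SkewBrace

section Closure

variable {B : Type u} {S : SkewBrace B} {A : Set B}

theorem subset_addClosure : A ⊆ addClosure S A := fun _ ha _ hH => hH.2.2.2 ha

theorem zero_mem_addClosure : S.zero ∈ addClosure S A := fun _ hH => hH.1

theorem add_mem_addClosure {a b : B} (ha : a ∈ addClosure S A) (hb : b ∈ addClosure S A) :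
    S.add a b ∈ addClosure S A :=
  fun H hH => hH.2.1 a (ha H hH) b (hb H hH)

theorem neg_mem_addClosure {a : B} (ha : a ∈ addClosure S A) : S.neg a ∈ addClosure S A :=
  fun H hH => hH.2.2.1 a (ha H hH)

theorem subset_mulClosure : A ⊆ mulClosure S A := fun _ ha _ hH => hH.2.2.2 ha

theorem zero_mem_mulClosure : S.zero ∈ mulClosure S A := fun _ hH => hH.1

theorem mul_mem_mulClosure {a b : B} (ha : a ∈ mulClosure S A) (hb : b ∈ mulClosure S A) :
    S.mul a b ∈ mulClosure S A :=
  fun H hH => hH.2.1 a (ha H hH) b (hb H hH)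

theorem inv_mem_mulClosure {a : B} (ha : a ∈ mulClosure S A) : S.inv a ∈ mulClosure S A :=
  fun H hH => hH.2.2.1 a (ha H hH)

/-- An additive endomorphism mapping `A` into itself maps its additive closure into itself. -/
theorem map_mem_addClosure {φ : B → B} (h0 : φ S.zero = S.zero)
    (hadd : ∀ a b, φ (S.add a b) = S.add (φ a) (φ b)) (hneg : ∀ a, φ (S.neg a) = S.neg (φ a))
    (hA : ∀ a ∈ A, φ a ∈ A) {a : B} (ha : a ∈ addClosure S A) : φ a ∈ addClosure S A := by
  refine ha {b | φ b ∈ addClosure S A} ⟨?_, fun b hb c hc => ?_, fun b hb => ?_, fun b hb => ?_⟩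
  · simpa only [Set.mem_ofPred_eq, h0] using zero_mem_addClosure
  · simpa only [Set.mem_ofPred_eq, hadd] using add_mem_addClosure hb hc
  · simpa only [Set.mem_ofPred_eq, hneg] using neg_mem_addClosure hb
  · exact subset_addClosure (hA b hb)

theorem lam_mem_addClosure (hA : ∀ g, ∀ a ∈ A, S.lam g a ∈ A) (g : B) {a : B}
    (ha : a ∈ addClosure S A) : S.lam g a ∈ addClosure S A :=
  map_mem_addClosure (S.lam_zero_right g) (S.lam_add g) (S.lam_neg g) (hA g) ha

theorem mulClosure_eq_addClosure (hA : ∀ g, ∀ a ∈ A, S.lam g a ∈ A) :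
    mulClosure S A = addClosure S A := by
  apply Set.Subset.antisymm
  · refine fun m hm => hm _ ⟨zero_mem_addClosure, fun a ha b hb => ?_, fun a ha => ?_,
      subset_addClosure⟩
    · rw [S.mul_eq_add_lam]
      exact add_mem_addClosure ha (lam_mem_addClosure hA a hb)
    · rw [S.inv_eq_neg_lam]
      exact neg_mem_addClosure (lam_mem_addClosure hA _ ha)
  · have hadd : ∀ a ∈ A, ∀ m ∈ mulClosure S A, S.add m a ∈ mulClosure S A := by
      intro a ha m hm
      have h : S.add m a = S.mul m (S.lam (S.inv m) a) := by
        rw [S.mul_eq_add_lam, S.lam_lam_inv]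
      rw [h]
      exact mul_mem_mulClosure hm (subset_mulClosure (hA _ a ha))
    have hneg : ∀ a ∈ A, S.neg a ∈ mulClosure S A := by
      intro a ha
      rw [← S.inv_inv (S.neg a)]
      refine inv_mem_mulClosure (subset_mulClosure ?_)
      rw [S.inv_eq_neg_lam, ← S.lam_neg, S.neg_neg]
      exact hA _ a ha
    have hsub : ∀ a ∈ A, ∀ m ∈ mulClosure S A, S.add m (S.neg a) ∈ mulClosure S A := by
      intro a ha m hm
      have h : S.add m (S.neg a) = S.mul m (S.neg (S.lam (S.inv m) a)) := by
        rw [S.mul_eq_add_lam, S.lam_neg, S.lam_lam_inv]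
      rw [h]
      exact mul_mem_mulClosure hm (hneg _ (hA _ a ha))
    have key : addClosure S A ⊆
        {h | ∀ m, S.add m h ∈ mulClosure S A ↔ m ∈ mulClosure S A} := by
      refine fun h hh => hh _ ⟨fun m => by rw [S.add_zero], fun a ha b hb m => ?_,
        fun a ha m => ?_, fun a ha m => ⟨fun hm => ?_, hadd a ha m⟩⟩
      · rw [← S.add_assoc, hb, ha]
      · rw [← ha, S.add_assoc, S.neg_add, S.add_zero]
      · simpa only [S.add_assoc, S.add_neg, S.add_zero] using hsub a ha _ hm
    intro h hh
    simpa only [S.zero_add] using (key hh S.zero).2 zero_mem_mulClosure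

theorem isStrongLeftIdeal_addClosure (hA : ∀ g, ∀ a ∈ A, S.lam g a ∈ A)
    (hconj : ∀ g, ∀ a ∈ A, S.add (S.add g a) (S.neg g) ∈ A) :
    IsStrongLeftIdeal S (addClosure S A) := by
  refine ⟨zero_mem_addClosure, fun a ha b hb => add_mem_addClosure ha hb,
    fun a ha => neg_mem_addClosure ha, fun g => Set.Subset.antisymm ?_ fun a ha => ?_,
    fun g a ha => map_mem_addClosure (φ := fun a => S.add (S.add g a) (S.neg g))
      ?_ ?_ ?_ (hconj g) ha⟩
  · rintro _ ⟨a, ha, rfl⟩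
    exact lam_mem_addClosure hA g ha
  · exact ⟨_, lam_mem_addClosure hA (S.inv g) ha, S.lam_lam_inv g a⟩
  · simp only [S.add_zero, S.add_neg]
  · simp only [S.add_assoc, S.neg_add_cancel_left, implies_true]
  · simp only [S.neg_add_rev, S.neg_neg, S.add_assoc, implies_true]

end Closure

namespace StructureBrace

variable {X : Type u} {r : X × X → X × X} (GX : StructureBrace r)

theorem lam_ι (x y : X) : GX.S.lam (GX.ι x) (GX.ι y) = GX.ι (r (x, y)).1 :=
  (congrArg Prod.fst (congrFun GX.compat (x, y))).symm

theorem rho_ι (x y : X) : GX.S.rho (GX.ι y) (GX.ι x) = GX.ι (r (x, y)).2 :=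
  (congrArg Prod.snd (congrFun GX.compat (x, y))).symm

theorem ι_add_ι (x y : X) :
    GX.S.add (GX.ι x) (GX.ι (r (x, y)).1) =
      GX.S.add (GX.ι (r (x, y)).1) (GX.S.lam (GX.ι (r (x, y)).1) (GX.ι (r (x, y)).2)) := by
  rw [← GX.lam_ι, ← GX.rho_ι, GX.S.lam_add_lam_rho]

/-- A set on which every `λ_{ι x}` restricts to a bijection is `λ`-invariant. -/
theorem lam_mem_iff {A : Set GX.G} (hA : ∀ x a, GX.S.lam (GX.ι x) a ∈ A ↔ a ∈ A)
    (g a : GX.G) : GX.S.lam g a ∈ A ↔ a ∈ A := by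
  have h := GX.gen {g | ∀ a, GX.S.lam g a ∈ A ↔ a ∈ A}
    (fun a => by rw [GX.S.lam_zero_left]) (fun b hb c hc a => by rw [GX.S.lam_mul, hb, hc])
    (fun b hb a => by rw [← hb, GX.S.lam_lam_inv]) (by rintro _ ⟨x, rfl⟩; exact hA x)
  exact (h ▸ Set.mem_univ g : g ∈ {g | ∀ a, GX.S.lam g a ∈ A ↔ a ∈ A}) a

/-- A `λ`-invariant set normalized additively by `ι(X)` is normalized by the whole skew brace. -/
theorem conj_mem_iff {A : Set GX.G} (hlam : ∀ g a, GX.S.lam g a ∈ A ↔ a ∈ A)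
    (hA : ∀ x a, GX.S.add (GX.S.add (GX.ι x) a) (GX.S.neg (GX.ι x)) ∈ A ↔ a ∈ A)
    (g a : GX.G) : GX.S.add (GX.S.add g a) (GX.S.neg g) ∈ A ↔ a ∈ A := by
  set S := GX.S
  let N : Set GX.G := {g | ∀ a, S.add (S.add g a) (S.neg g) ∈ A ↔ a ∈ A}
  have hN : ∀ b, ∀ g ∈ N, S.lam b g ∈ N := by
    intro b g hg a
    obtain ⟨c, rfl⟩ : ∃ c, S.lam b c = a := ⟨_, S.lam_lam_inv b a⟩
    rw [← S.lam_neg, ← S.lam_add, ← S.lam_add, hlam, hg, hlam]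
  have hneg : ∀ g ∈ N, S.neg g ∈ N := by
    intro g hg a
    rw [← hg]
    simp only [S.neg_neg, S.add_assoc, S.add_neg_cancel_left, S.add_neg, S.add_zero]
  have hadd : ∀ g ∈ N, ∀ h ∈ N, S.add g h ∈ N := by
    intro g hg h hh a
    rw [← hh a, ← hg (S.add (S.add h a) (S.neg h))]
    simp only [S.neg_add_rev, S.add_assoc]
  have h := GX.gen N
    (fun a => by simp only [S, GX.S.neg_zero, GX.S.zero_add, GX.S.add_zero])
    (fun b hb c hc => by
      rw [GX.S.mul_eq_add_lam]
      exact hadd b hb _ (hN b c hc))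
    (fun b hb => by
      rw [GX.S.inv_eq_neg_lam]
      exact hneg _ (hN _ b hb))
    (by rintro _ ⟨x, rfl⟩; exact hA x)
  exact (h ▸ Set.mem_univ g : g ∈ N) a

end StructureBrace

namespace IsIKernel

variable {X U : Type u} {r : X × X → X × X} {s : U × U → U × U} {f : X → U} {X₀ : Set X}

theorem lam_mem_iff (hik : IsIKernel r s f X₀) (hsn : Nondeg s) (z x : X) :
    (r (z, x)).1 ∈ X₀ ↔ x ∈ X₀ := by
  obtain ⟨hf, ⟨x₀, rfl⟩, hker⟩ := hik
  have hmem : ∀ y ∈ kerClass f x₀, (r (z, y)).1 ∈ kerClass f x₀ := fun y hy =>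
    ((hker z).2.subset ⟨(z, y), ⟨rfl, hy⟩, rfl⟩).1
  refine ⟨fun h => (hsn.1 (f z)).1 ?_, hmem x⟩
  have hfst : ∀ y, f (r (z, y)).1 = lamMap s (f z) (f y) := fun y =>
    congrArg Prod.fst (congrFun hf (z, y))
  rw [← hfst, ← hfst]
  exact h.trans (hmem x₀ rfl).symm

theorem lam_ι_mem_iff (hik : IsIKernel r s f X₀) (hrn : Nondeg r) (hsn : Nondeg s)
    (GX : StructureBrace r) (z : X) (a : GX.G) :
    GX.S.lam (GX.ι z) a ∈ GX.ι '' X₀ ↔ a ∈ GX.ι '' X₀ := by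
  constructor
  · rintro ⟨y, hy, hya⟩
    obtain ⟨x, hx : (r (z, x)).1 = y⟩ := (hrn.1 z).2 y
    refine ⟨x, (hik.lam_mem_iff hsn z x).1 (hx ▸ hy), ?_⟩
    rw [← GX.S.lam_inv_lam (GX.ι z) a, ← hya, ← hx, ← GX.lam_ι, GX.S.lam_inv_lam]
  · rintro ⟨x, hx, rfl⟩
    exact ⟨_, (hik.lam_mem_iff hsn z x).2 hx, (GX.lam_ι z x).symm⟩

theorem conj_ι_mem_iff (hik : IsIKernel r s f X₀) (hrn : Nondeg r) (GX : StructureBrace r)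
    (hlam : ∀ g a, GX.S.lam g a ∈ GX.ι '' X₀ ↔ a ∈ GX.ι '' X₀) (z : X) (a : GX.G) :
    GX.S.add (GX.S.add (GX.ι z) a) (GX.S.neg (GX.ι z)) ∈ GX.ι '' X₀ ↔ a ∈ GX.ι '' X₀ := by
  constructor
  · rintro ⟨u, hu, hua⟩
    obtain ⟨v, hv : (r (u, v)).1 = z⟩ := (hrn.1 u).2 z
    have hq : (r (u, v)).2 ∈ X₀ := ((hik.2.2 v).1.subset ⟨(u, v), ⟨hu, rfl⟩, rfl⟩).2
    have h := GX.ι_add_ι u v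
    rw [hv, hua, GX.S.add_assoc, GX.S.neg_add, GX.S.add_zero] at h
    have ha := congrArg (GX.S.add (GX.S.neg (GX.ι z))) h
    rw [GX.S.neg_add_cancel_left, GX.S.neg_add_cancel_left] at ha
    rw [ha, hlam]
    exact ⟨_, hq, rfl⟩
  · intro ha
    obtain ⟨q, hq, hqa⟩ := (hlam (GX.S.inv (GX.ι z)) a).2 ha
    obtain ⟨⟨u, v⟩, ⟨hu, -⟩, huv⟩ :=
      (hik.2.2 z).1.superset (⟨rfl, hq⟩ : (z, q) ∈ kerClass f z ×ˢ X₀)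
    have h := GX.ι_add_ι u v
    rw [huv] at h
    refine ⟨u, hu, ?_⟩
    rw [← GX.S.lam_lam_inv (GX.ι z) a, ← hqa, ← h, GX.S.add_assoc, GX.S.add_neg, GX.S.add_zero]

end IsIKernel

/-- For an i-homomorphism of non-degenerate solutions with i-kernel
`X₀`, the multiplicative and additive subgroups of `G_X` generated by `ι(X₀)`
coincide, and this subgroup is a strong left ideal of `G_X`. -/
theorem stmt_10 {X U : Type u} (r : X × X → X × X) (s : U × U → U × U)
    (hr : IsSolution r) (hrn : Nondeg r) (hs : IsSolution s) (hsn : Nondeg s)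
    (f : X → U) (X₀ : Set X) (hik : IsIKernel r s f X₀)
    (GX : StructureBrace r) :
    mulClosure GX.S (GX.ι '' X₀) = addClosure GX.S (GX.ι '' X₀) ∧
    IsStrongLeftIdeal GX.S (mulClosure GX.S (GX.ι '' X₀)) := by
  have hlam := GX.lam_mem_iff (hik.lam_ι_mem_iff hrn hsn GX)
  have hconj := GX.conj_mem_iff hlam (hik.conj_ι_mem_iff hrn GX hlam)
  have heq := mulClosure_eq_addClosure fun g a => (hlam g a).2
  refine ⟨heq, ?_⟩
  rw [heq]
  exact isStrongLeftIdeal_addClosure (fun g a => (hlam g a).2) fun g a => (hconj g a).2
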